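/- Let k = 2 and r ≥ 3, t ≥ 3, e ≥ t+1. Let F be an r-uniform hypergraph on [n] that is G_r(er-2(e-1), e)-free, G_r(ir-2(i-1)-1, i)-free for all t ≤ i ≤ e-1, and in which every vertex has degree 0 or at least e. Suppose X ⊆ [n] is the union of t-1 distinct edges A_1,...,A_{t-1} of F with |X| = (t-1)r-2(t-2)-1. Then {A ∈ F : A ∩ X ≠ ∅} = I(X) ∪ {A_1,...,A_{t-1}}, where I(X) = {A ∈ F \ {A_1,...,A_{t-1}} : |A ∩ X| = 1}. -/

import Mathlib

open Finset

/-- `F` is an `r`-uniform hypergraph: every edge has `r` vertices. -/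
def UniformH {n : ℕ} (r : ℕ) (F : Finset (Finset (Fin n))) : Prop :=
  ∀ A ∈ F, A.card = r

/-- `F` is `G_r(v,e)`-free: any `e` distinct edges have union of size at least `v+1`. -/
def IsGFree {n : ℕ} (v e : ℕ) (F : Finset (Finset (Fin n))) : Prop :=
  ∀ S ⊆ F, S.card = e → v + 1 ≤ (S.biUnion id).card

/-- `f_r(n,v,e)`: the maximum number of edges of an `n`-vertex `G_r(v,e)`-free
`r`-uniform hypergraph. -/
noncomputable def extremalF (r n v e : ℕ) : ℕ :=
  sSup {m | ∃ F : Finset (Finset (Fin n)), UniformH r F ∧ IsGFree v e F ∧ F.card = m}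

theorem stmt_17 (n r e t : ℕ) (ht : 3 ≤ t) (hr : 3 ≤ r) (he : t + 1 ≤ e)
    (F : Finset (Finset (Fin n))) (hF : UniformH r F)
    (hfree1 : IsGFree (e * r - 2 * (e - 1)) e F)
    (hfree2 : ∀ i, t ≤ i → i ≤ e - 1 → IsGFree (i * r - 2 * (i - 1) - 1) i F)
    (hdeg : ∀ v : Fin n, (F.filter (fun A => v ∈ A)).card = 0 ∨
      e ≤ (F.filter (fun A => v ∈ A)).card)
    (S : Finset (Finset (Fin n))) (hS : S ⊆ F) (hScard : S.card = t - 1)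
    (X : Finset (Fin n)) (hXdef : X = S.biUnion id)
    (hX : X.card = (t - 1) * r - 2 * (t - 2) - 1) :
    F.filter (fun A => (A ∩ X).Nonempty) =
      F.filter (fun A => A ∉ S ∧ (A ∩ X).card = 1) ∪ S := by
  have key : ∀ A ∈ F, A ∉ S → (A ∩ X).card ≤ 1 := by
    intro A hA hAS
    by_contra hc
    push Not at hc
    have h1 := hfree2 t le_rfl (by omega) (insert A S)
      (Finset.insert_subset hA hS) (by rw [Finset.card_insert_of_notMem hAS]; omega)
    rw [Finset.biUnion_insert, ← hXdef] at h1
    have h2 := Finset.card_union_add_card_inter A X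
    have h3 := hF A hA
    simp only [id] at h1
    obtain ⟨s, rfl⟩ : ∃ s, t = s + 3 := ⟨t - 3, by omega⟩
    have e1 : s + 3 - 1 = s + 2 := by omega
    have e2 : (s + 3) * r = (s + 2) * r + r := by ring
    have e3 : (s + 2) * 3 ≤ (s + 2) * r := Nat.mul_le_mul_left _ hr
    rw [e1] at hX h1
    rw [e2] at h1
    omega
  ext A
  simp only [Finset.mem_filter, Finset.mem_union]
  constructor
  · rintro ⟨hA, hne⟩
    by_cases hAS : A ∈ S
    · exact Or.inr hAS
    · have := key A hA hAS
      have := hne.card_pos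
      exact Or.inl ⟨hA, hAS, by omega⟩
  · rintro (⟨hA, _, h⟩ | hAS)
    · exact ⟨hA, Finset.card_pos.mp (by omega)⟩
    · refine ⟨hS hAS, ?_⟩
      have hsub : A ⊆ X := by
        rw [hXdef]
        exact Finset.subset_biUnion_of_mem id hAS
      rw [Finset.inter_eq_left.mpr hsub]
      have := hF A (hS hAS)
      exact Finset.card_pos.mp (by omega)
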